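/- Let 𝓕 be a Kalton space on U with values in Σ, let s ∈ U, let c ≥ 1 and let B_s be a homogeneous bounded selection for δ_s with constant c, with associated derivation Ω_s = δ'_s ∘ B_s. Then for every f ∈ 𝓕 one has Ω_s(f(s)) − f'(s) ∈ X_s, with ‖Ω_s(f(s)) − f'(s)‖_s ≤ (1+c)·‖δ'_s : ker δ_s → X_s‖·‖f‖_𝓕, where ‖δ'_s : ker δ_s → X_s‖ is the operator norm of the map g ↦ g'(s) from ker δ_s to X_s. -/

import Mathlib

open Complex Metric Set

noncomputable section

/-- A conformal equivalence (analytic bijection) of `U` onto `V`. -/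
def ConformalEquivOn (φ : ℂ → ℂ) (U V : Set ℂ) : Prop :=
  DifferentiableOn ℂ φ U ∧ Set.BijOn φ U V

/-- A Kalton space of analytic functions on an open set `U ⊆ ℂ` conformally equivalent to the
open unit disc, with values in the complex Banach space `Sig`.  The Banach carrier is `F`, whose
elements are identified with analytic functions `ℂ → Sig` (only the restriction to `U` matters)
via the injective linear map `toFun`. -/
structure KaltonSpace (U : Set ℂ) (Sig : Type*) (F : Type*)
    [NormedAddCommGroup Sig] [NormedSpace ℂ Sig] [CompleteSpace Sig]
    [NormedAddCommGroup F] [NormedSpace ℂ F] [CompleteSpace F] where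
  isOpen : IsOpen U
  conformal_exists : ∃ φ : ℂ → ℂ, ConformalEquivOn φ U (Metric.ball (0 : ℂ) 1)
  toFun : F →ₗ[ℂ] (ℂ → Sig)
  inj : ∀ f g : F, Set.EqOn (toFun f) (toFun g) U → f = g
  analytic : ∀ f : F, DifferentiableOn ℂ (toFun f) U
  eval_bound : ∀ z ∈ U, ∃ C : ℝ, ∀ f : F, ‖toFun f z‖ ≤ C * ‖f‖
  conf_mul_mem : ∀ φ : ℂ → ℂ, ConformalEquivOn φ U (Metric.ball (0 : ℂ) 1) →
    ∀ f : F, ∃ g : F, (∀ z ∈ U, toFun g z = φ z • toFun f z) ∧ ‖g‖ = ‖f‖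
  conf_div_mem : ∀ φ : ℂ → ℂ, ConformalEquivOn φ U (Metric.ball (0 : ℂ) 1) →
    ∀ h : ℂ → Sig, DifferentiableOn ℂ h U →
    ∀ g : F, (∀ z ∈ U, toFun g z = φ z • h z) →
    ∃ f : F, (∀ z ∈ U, toFun f z = h z) ∧ ‖f‖ = ‖g‖

namespace KaltonSpace

variable {U : Set ℂ} {Sig F : Type*}
  [NormedAddCommGroup Sig] [NormedSpace ℂ Sig] [CompleteSpace Sig]
  [NormedAddCommGroup F] [NormedSpace ℂ F] [CompleteSpace F]

/-- `x` belongs to the interpolation space `X_z = {f z : f ∈ 𝓕}`. -/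
def MemX (K : KaltonSpace U Sig F) (z : ℂ) (x : Sig) : Prop :=
  ∃ f : F, K.toFun f z = x

/-- The quotient norm `‖x‖_z = inf {‖f‖ : f ∈ 𝓕, f z = x}` of `X_z`. -/
def normX (K : KaltonSpace U Sig F) (z : ℂ) (x : Sig) : ℝ :=
  sInf {r : ℝ | ∃ f : F, K.toFun f z = x ∧ r = ‖f‖}

/-- `B` is a homogeneous bounded selection for the evaluation `δ_z`, with constant `c`. -/
def IsSelection (K : KaltonSpace U Sig F) (z : ℂ) (c : ℝ) (B : Sig → F) : Prop :=
  (∀ (l : ℂ) (x : Sig), K.MemX z x → B (l • x) = l • B x) ∧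
  (∀ x : Sig, K.MemX z x → K.toFun (B x) z = x) ∧
  (∀ x : Sig, K.MemX z x → ‖B x‖ ≤ c * K.normX z x)

end KaltonSpace

/-- An analytic function that is injective near a point has nonzero derivative there. -/
theorem AnalyticAt.deriv_ne_zero_of_injOn {φ : ℂ → ℂ} {s : ℂ} {U : Set ℂ}
    (hφ : AnalyticAt ℂ φ s) (hU : U ∈ nhds s) (hinj : Set.InjOn φ U) : deriv φ s ≠ 0 := by
  have hsU : s ∈ U := mem_of_mem_nhds hU
  have hnc : ¬ ∀ᶠ z in nhds s, φ z - φ s = 0 := by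
    intro h
    have h' : ∀ᶠ z in nhdsWithin s {s}ᶜ, z ∈ U ∧ φ z - φ s = 0 ∧ z ≠ s :=
      Filter.Eventually.and (nhdsWithin_le_nhds hU) <|
        Filter.Eventually.and (nhdsWithin_le_nhds h) self_mem_nhdsWithin
    obtain ⟨z, hz, hzφ, hzs⟩ := h'.exists
    exact hzs (hinj hz hsU (sub_eq_zero.mp hzφ))
  obtain ⟨n, u, hu, hus, hev⟩ :=
    (hφ.sub (analyticAt_const (v := φ s))).exists_eventuallyEq_pow_smul_nonzero_iff.mpr hnc
  replace hev : ∀ᶠ z in nhds s, φ z - φ s = (z - s) ^ n • u z := hev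
  have hn0 : n ≠ 0 := by
    rintro rfl
    have := hev.self_of_nhds
    simp at this
    exact hus this.symm
  -- `w` is a local coordinate at `s` in which `φ - φ s` is a multiple of the `n`-th power.
  set v : ℂ → ℂ := fun z => (u z / u s) ^ (1 / n : ℂ) with hv
  set w : ℂ → ℂ := fun z => (z - s) * v z with hw
  have hvan : AnalyticAt ℂ v s := by
    refine AnalyticAt.cpow (hu.div analyticAt_const hus) analyticAt_const ?_
    simp [div_self hus]
  have hvs : v s = 1 := by simp [hv, div_self hus]
  have hvpow : ∀ z, v z ^ n = u z / u s := by
    intro z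
    simp only [hv, one_div]
    exact Complex.cpow_nat_inv_pow _ hn0
  have hwan : AnalyticAt ℂ w s := (analyticAt_id.sub analyticAt_const).mul hvan
  have hwd : HasStrictDerivAt w 1 s := by
    have h := hwan.hasStrictDerivAt
    have h2 : HasDerivAt w 1 s := by
      have h3 := ((hasDerivAt_id s).sub_const s).mul hvan.differentiableAt.hasDerivAt
      simp only [id, sub_self, zero_mul, add_zero, one_mul, hvs] at h3
      exact h3
    rwa [h2.deriv] at h
  have hws : w s = 0 := by simp [hw]
  have hφw : ∀ᶠ z in nhds s, φ z - φ s = u s * w z ^ n := by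
    filter_upwards [hev] with z hz
    rw [hz, hw, mul_pow, hvpow, smul_eq_mul]
    field_simp
  have hN : w '' (U ∩ {z | φ z - φ s = u s * w z ^ n}) ∈ nhds (0 : ℂ) := by
    rw [← hws, ← hwd.map_nhds_eq one_ne_zero]
    exact Filter.image_mem_map (Filter.inter_mem hU hφw)
  have hn1 : n = 1 := by
    have hω := Complex.isPrimitiveRoot_exp n hn0
    set ω := Complex.exp (2 * Real.pi * Complex.I / n)
    have hωN : ∀ᶠ ζ in nhds (0 : ℂ),
        ω * ζ ∈ w '' (U ∩ {z | φ z - φ s = u s * w z ^ n}) := by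
      have hc : Filter.Tendsto (fun ζ : ℂ => ω * ζ) (nhds 0) (nhds 0) := by
        simpa using (continuous_const_mul ω).tendsto 0
      exact hc hN
    have h' : ∀ᶠ ζ in nhdsWithin (0 : ℂ) {0}ᶜ, _ ∧ _ ∧ ζ ≠ 0 :=
      Filter.Eventually.and (nhdsWithin_le_nhds hN) <|
        Filter.Eventually.and (nhdsWithin_le_nhds hωN) self_mem_nhdsWithin
    obtain ⟨ζ, ⟨x, ⟨hxU, hx⟩, hxζ⟩, ⟨y, ⟨hyU, hy⟩, hyζ⟩, hζ⟩ := h'.exists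
    have hxy : x = y := by
      apply hinj hxU hyU
      simp only [Set.mem_ofPred_eq] at hx hy
      rw [hxζ] at hx
      rw [hyζ, mul_pow, hω.pow_eq_one, one_mul] at hy
      linear_combination hx - hy
    have hω1 : ω = 1 := by
      rw [← hxy, hxζ] at hyζ
      exact mul_right_cancel₀ hζ (by rw [one_mul, ← hyζ])
    exact hω.unique (hω1 ▸ IsPrimitiveRoot.one)
  subst hn1
  have hd : HasDerivAt (fun z => φ s + (z - s) * u z) (u s) s := by
    have h := (((hasDerivAt_id s).sub_const s).mul hu.differentiableAt.hasDerivAt).const_add (φ s)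
    simp only [id, sub_self, zero_mul, add_zero, one_mul] at h
    exact h
  have hφd : HasDerivAt φ (u s) s := by
    refine hd.congr_of_eventuallyEq ?_
    filter_upwards [hev] with z hz
    rw [pow_one, smul_eq_mul] at hz
    rw [← hz]
    ring
  rwa [hφd.deriv]

open scoped ComplexConjugate in
/-- For points `a`, `z` of the unit disc, the denominator of the disc automorphism moving `a`
to the origin does not vanish at `z`. -/
theorem one_sub_conj_mul_ne_zero {a z : ℂ} (ha : ‖a‖ < 1) (hz : ‖z‖ < 1) :
    1 - conj a * z ≠ 0 := by
  intro h
  have h1 : ‖conj a * z‖ = 1 := by rw [← sub_eq_zero.mp h, norm_one]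
  rw [norm_mul, Complex.norm_conj] at h1
  nlinarith [norm_nonneg a, norm_nonneg z]

open scoped ComplexConjugate in
theorem norm_sub_div_one_sub_conj_mul_lt_one {a z : ℂ} (ha : ‖a‖ < 1) (hz : ‖z‖ < 1) :
    ‖(z - a) / (1 - conj a * z)‖ < 1 := by
  have h0 := one_sub_conj_mul_ne_zero ha hz
  rw [norm_div, div_lt_one (norm_pos_iff.mpr h0)]
  refine lt_of_pow_lt_pow_left₀ 2 (norm_nonneg _) ?_
  have ha2 : ‖a‖ ^ 2 < 1 := by nlinarith [norm_nonneg a]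
  have hz2 : ‖z‖ ^ 2 < 1 := by nlinarith [norm_nonneg z]
  have key : ‖1 - conj a * z‖ ^ 2 - ‖z - a‖ ^ 2 = (1 - ‖a‖ ^ 2) * (1 - ‖z‖ ^ 2) := by
    simp only [Complex.sq_norm, Complex.normSq_apply, Complex.sub_re, Complex.sub_im,
      Complex.mul_re, Complex.mul_im, Complex.conj_re, Complex.conj_im, Complex.one_re,
      Complex.one_im]
    ring
  nlinarith [mul_pos (sub_pos.mpr ha2) (sub_pos.mpr hz2)]

open scoped ComplexConjugate in
/-- The disc automorphism moving `a` to the origin. -/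
theorem conformalEquivOn_ball_sub_div {a : ℂ} (ha : ‖a‖ < 1) :
    ConformalEquivOn (fun z => (z - a) / (1 - conj a * z)) (ball 0 1) (ball 0 1) := by
  have hna : ‖-a‖ < 1 := by rwa [norm_neg]
  have haa : 1 - conj a * a ≠ 0 := one_sub_conj_mul_ne_zero ha ha
  refine ⟨?_, ?_, ?_, ?_⟩
  · intro z hz
    have h0 := one_sub_conj_mul_ne_zero ha (mem_ball_zero_iff.mp hz)
    exact DifferentiableAt.differentiableWithinAt (by fun_prop (disch := exact h0))
  · intro z hz
    exact mem_ball_zero_iff.mpr (norm_sub_div_one_sub_conj_mul_lt_one ha (mem_ball_zero_iff.mp hz))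
  · intro z hz y hy h
    have hz0 := one_sub_conj_mul_ne_zero ha (mem_ball_zero_iff.mp hz)
    have hy0 := one_sub_conj_mul_ne_zero ha (mem_ball_zero_iff.mp hy)
    simp only at h
    rw [div_eq_div_iff hz0 hy0] at h
    refine sub_eq_zero.mp ((mul_eq_zero.mp ?_).resolve_left haa)
    linear_combination h
  · intro y hy
    have hy1 := mem_ball_zero_iff.mp hy
    have hden := one_sub_conj_mul_ne_zero hna hy1
    have hx := norm_sub_div_one_sub_conj_mul_lt_one hna hy1
    refine ⟨_, mem_ball_zero_iff.mpr hx, ?_⟩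
    have hx0 := one_sub_conj_mul_ne_zero ha hx
    simp only
    rw [div_eq_iff hx0]
    simp only [map_neg, neg_mul, sub_neg_eq_add] at hden ⊢
    have hX := div_mul_cancel₀ (y + a) hden
    refine mul_right_cancel₀ hden ?_
    linear_combination (1 + y * conj a) * hX

theorem ConformalEquivOn.comp {φ ψ : ℂ → ℂ} {U V W : Set ℂ} (hψ : ConformalEquivOn ψ V W)
    (hφ : ConformalEquivOn φ U V) : ConformalEquivOn (ψ ∘ φ) U W :=
  ⟨hψ.1.comp hφ.1 hφ.2.mapsTo, hψ.2.comp hφ.2⟩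

namespace KaltonSpace

variable {U : Set ℂ} {Sig F : Type*}
  [NormedAddCommGroup Sig] [NormedSpace ℂ Sig] [CompleteSpace Sig]
  [NormedAddCommGroup F] [NormedSpace ℂ F] [CompleteSpace F]

theorem normX_le (K : KaltonSpace U Sig F) (z : ℂ) (f : F) :
    K.normX z (K.toFun f z) ≤ ‖f‖ := by
  refine csInf_le ⟨0, ?_⟩ ⟨f, rfl, rfl⟩
  rintro r ⟨g, -, rfl⟩
  exact norm_nonneg g

theorem differentiableAt (K : KaltonSpace U Sig F) {s : ℂ} (hs : s ∈ U) (f : F) :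
    DifferentiableAt ℂ (K.toFun f) s :=
  (K.analytic f).differentiableAt (K.isOpen.mem_nhds hs)

theorem exists_conformalEquivOn_eq_zero (K : KaltonSpace U Sig F) {s : ℂ} (hs : s ∈ U) :
    ∃ φ : ℂ → ℂ, ConformalEquivOn φ U (ball 0 1) ∧ φ s = 0 := by
  obtain ⟨φ, hφ⟩ := K.conformal_exists
  have ha : ‖φ s‖ < 1 := mem_ball_zero_iff.mp (hφ.2.mapsTo hs)
  exact ⟨_, (conformalEquivOn_ball_sub_div ha).comp hφ, by simp⟩

/-- The derivative at `s` maps `ker δ_s` into `X_s`. -/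
theorem memX_deriv_of_eq_zero (K : KaltonSpace U Sig F) {s : ℂ} (hs : s ∈ U) (g : F)
    (hg : K.toFun g s = 0) : K.MemX s (deriv (K.toFun g) s) := by
  obtain ⟨φ, hφ, hφs⟩ := K.exists_conformalEquivOn_eq_zero hs
  have hU := K.isOpen.mem_nhds hs
  have hφ' : deriv φ s ≠ 0 :=
    (hφ.1.analyticAt hU).deriv_ne_zero_of_injOn hU hφ.2.injOn
  have hne : ∀ z ∈ U, dslope φ s z ≠ 0 := by
    intro z hz h0
    rcases eq_or_ne z s with rfl | hzs
    · exact hφ' (by rwa [dslope_same] at h0)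
    · have h := sub_smul_dslope φ s z
      rw [h0, smul_zero] at h
      exact hzs (hφ.2.injOn hz hs (sub_eq_zero.mp h.symm))
  have hh : DifferentiableOn ℂ (fun z => (dslope φ s z)⁻¹ • dslope (K.toFun g) s z) U :=
    (((Complex.differentiableOn_dslope hU).mpr hφ.1).inv hne).smul
      ((Complex.differentiableOn_dslope hU).mpr (K.analytic g))
  obtain ⟨f, hf, -⟩ := K.conf_div_mem φ hφ _ hh g (by
    intro z hz
    have h1 := sub_smul_dslope φ s z
    have h2 := sub_smul_dslope (K.toFun g) s z
    rw [hφs, sub_zero, smul_eq_mul] at h1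
    rw [hg, sub_zero] at h2
    rw [← h2, ← h1, smul_smul, mul_assoc, mul_inv_cancel₀ (hne z hz), mul_one])
  refine ⟨deriv φ s • f, ?_⟩
  rw [map_smul, Pi.smul_apply, hf s hs, dslope_same, dslope_same, smul_inv_smul₀ hφ']

end KaltonSpace

/-- For every `f ∈ 𝓕` one has `Ω_s(f(s)) − f'(s) ∈ X_s`, with
`‖Ω_s(f(s)) − f'(s)‖_s ≤ (1+c)·‖δ'_s : ker δ_s → X_s‖·‖f‖`.  The operator norm of
`δ'_s : ker δ_s → X_s` is encoded by quantifying over all of its upper bounds `C`. -/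
theorem statement8 (U : Set ℂ) (Sig F : Type*)
    [NormedAddCommGroup Sig] [NormedSpace ℂ Sig] [CompleteSpace Sig]
    [NormedAddCommGroup F] [NormedSpace ℂ F] [CompleteSpace F]
    (K : KaltonSpace U Sig F) (s : ℂ) (hs : s ∈ U)
    (c : ℝ) (hc : 1 ≤ c) (B : Sig → F) (hB : K.IsSelection s c B) :
    ∀ C : ℝ, 0 ≤ C →
      (∀ g : F, K.toFun g s = 0 → K.normX s (deriv (K.toFun g) s) ≤ C * ‖g‖) →
      ∀ f : F,
        K.MemX s (deriv (K.toFun (B (K.toFun f s))) s - deriv (K.toFun f) s) ∧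
        K.normX s (deriv (K.toFun (B (K.toFun f s))) s - deriv (K.toFun f) s) ≤
          (1 + c) * C * ‖f‖ := by
  intro C hC hbound f
  obtain ⟨-, hval, hnorm⟩ := hB
  have hf : K.MemX s (K.toFun f s) := ⟨f, rfl⟩
  set g : F := B (K.toFun f s) - f with hg
  have hgs : K.toFun g s = 0 := by
    rw [hg, map_sub, Pi.sub_apply, hval _ hf, sub_self]
  have hderiv : deriv (K.toFun g) s =
      deriv (K.toFun (B (K.toFun f s))) s - deriv (K.toFun f) s := by
    rw [hg, map_sub]
    exact deriv_sub (K.differentiableAt hs _) (K.differentiableAt hs _)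
  rw [← hderiv]
  refine ⟨K.memX_deriv_of_eq_zero hs g hgs, (hbound g hgs).trans ?_⟩
  have hgn : ‖g‖ ≤ (1 + c) * ‖f‖ := by
    have h1 : ‖B (K.toFun f s)‖ ≤ c * ‖f‖ :=
      (hnorm _ hf).trans (mul_le_mul_of_nonneg_left (K.normX_le s f) (by linarith))
    linarith [norm_sub_le (B (K.toFun f s)) f]
  calc C * ‖g‖ ≤ C * ((1 + c) * ‖f‖) := mul_le_mul_of_nonneg_left hgn hC
    _ = (1 + c) * C * ‖f‖ := by ring
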